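/- Let k > 1 be an integer and let α, β be real numbers with 0 < α < β < 1. With X_γ^σ ⊆ ℂ^{3k-1} defined as below for γ ∈ {α, β} and 1 ≤ σ ≤ k−1, one has ⋂_{σ=1}^{k-1} (X_α^σ ∩ X_β^σ) = {O}, where O is the origin of ℂ^{3k-1}. -/

import Mathlib

open scoped ComplexConjugate

noncomputable section

/-- The set `X_γ^σ ⊆ ℂ^{3k-1}`, in coordinates `Z = (z, w₁, …, w_{2k-2}, ζ₁, …, ζ_k)`:
`z + γ(w₁ + w_{2σ-1})/(2γ+2) − iγ(w₂ + w_{2σ})/(2−2γ) = 0`,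
`γ(ζ₁ + ζ_σ) + ζ_k + conj(z)² = 0`, and `Im w₁ = ⋯ = Im w_{2k-2} = 0`. -/
def xSet (k : ℕ) (hk : 1 < k) (γ : ℝ) (σ : ℕ) (h1 : 1 ≤ σ) (h2 : σ ≤ k-1) :
    Set (EuclideanSpace ℂ (Fin (3*k-1))) :=
  {Z | Z ⟨0, by omega⟩
        + ((γ/(2*γ+2) : ℝ) : ℂ) * (Z ⟨1, by omega⟩ + Z ⟨2*σ-1, by omega⟩)
        - Complex.I * ((γ/(2-2*γ) : ℝ) : ℂ) * (Z ⟨2, by omega⟩ + Z ⟨2*σ, by omega⟩) = 0 ∧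
      (γ : ℂ) * (Z ⟨2*k-1, by omega⟩ + Z ⟨2*k-2+σ, by omega⟩) + Z ⟨3*k-2, by omega⟩
        + (conj (Z ⟨0, by omega⟩))^2 = 0 ∧
      ∀ τ : ℕ, ∀ _h1 : 1 ≤ τ, ∀ _h2 : τ ≤ 2*k-2, (Z ⟨τ, by omega⟩).im = 0}

theorem eq_zero_of_add_mul_sub_I_mul_eq_zero {a a' b b' : ℝ} (ha : a ≠ a') (hb : b ≠ b')
    {z p q : ℂ} (hp : p.im = 0) (hq : q.im = 0)
    (h : z + (a : ℂ) * p - Complex.I * (b : ℂ) * q = 0)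
    (h' : z + (a' : ℂ) * p - Complex.I * (b' : ℂ) * q = 0) :
    z = 0 ∧ p = 0 ∧ q = 0 := by
  have hd : ((a - a' : ℝ) : ℂ) * p - Complex.I * ((b - b' : ℝ) : ℂ) * q = 0 := by
    push_cast
    linear_combination h - h'
  have hre := congrArg Complex.re hd
  have him := congrArg Complex.im hd
  simp [-Complex.ofReal_sub, hp, hq, sub_eq_zero, ha] at hre
  simp [-Complex.ofReal_sub, hp, hq, sub_eq_zero, hb] at him
  have hp0 : p = 0 := Complex.ext hre hp
  have hq0 : q = 0 := Complex.ext him hq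
  subst hp0 hq0
  exact ⟨by simpa using h, rfl, rfl⟩

theorem eq_zero_of_mul_add_eq_zero {R : Type*} [CommRing R] [NoZeroDivisors R] {a b s t : R}
    (hab : a ≠ b) (ha : a * s + t = 0) (hb : b * s + t = 0) : s = 0 ∧ t = 0 := by
  have hs : s = 0 := by
    have : (a - b) * s = 0 := by linear_combination ha - hb
    exact (mul_eq_zero.mp this).resolve_left (sub_ne_zero.mpr hab)
  subst hs
  exact ⟨rfl, by simpa using ha⟩

theorem zero_mem_xSet (k : ℕ) (hk : 1 < k) (γ : ℝ) (σ : ℕ) (h1 : 1 ≤ σ) (h2 : σ ≤ k-1) :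
    0 ∈ xSet k hk γ σ h1 h2 := by
  simp [xSet]

theorem coords_of_mem_xSet_inter {k : ℕ} {hk : 1 < k} {α β : ℝ} (hα : 0 < α) (hαβ : α < β)
    (hβ : β < 1) {σ : ℕ} {h1 : 1 ≤ σ} {h2 : σ ≤ k-1} {Z : EuclideanSpace ℂ (Fin (3*k-1))}
    (hZ : Z ∈ xSet k hk α σ h1 h2 ∩ xSet k hk β σ h1 h2) :
    Z ⟨0, by omega⟩ = 0 ∧
      Z ⟨1, by omega⟩ + Z ⟨2*σ-1, by omega⟩ = 0 ∧
      Z ⟨2, by omega⟩ + Z ⟨2*σ, by omega⟩ = 0 ∧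
      Z ⟨2*k-1, by omega⟩ + Z ⟨2*k-2+σ, by omega⟩ = 0 ∧
      Z ⟨3*k-2, by omega⟩ = 0 := by
  obtain ⟨⟨hwα, hζα, him⟩, ⟨hwβ, hζβ, -⟩⟩ := hZ
  have ha : α/(2*α+2) ≠ β/(2*β+2) := by
    refine ne_of_lt ?_
    rw [div_lt_div_iff₀ (by linarith) (by linarith)]
    nlinarith
  have hb : α/(2-2*α) ≠ β/(2-2*β) := by
    refine ne_of_lt ?_
    rw [div_lt_div_iff₀ (by linarith) (by linarith)]
    nlinarith
  obtain ⟨hz, hp, hq⟩ := eq_zero_of_add_mul_sub_I_mul_eq_zero ha hb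
    (by rw [Complex.add_im, him 1 (by omega) (by omega), him (2*σ-1) (by omega) (by omega),
      add_zero])
    (by rw [Complex.add_im, him 2 (by omega) (by omega), him (2*σ) (by omega) (by omega),
      add_zero]) hwα hwβ
  simp only [hz, map_zero, ne_eq, OfNat.ofNat_ne_zero, not_false_eq_true, zero_pow,
    add_zero] at hζα hζβ
  obtain ⟨hs, ht⟩ := eq_zero_of_mul_add_eq_zero
    (Complex.ofReal_injective.ne hαβ.ne) hζα hζβ
  exact ⟨hz, hp, hq, hs, ht⟩

/-- For `0 < α < β < 1`, the sets `X_α^σ ∩ X_β^σ`, `1 ≤ σ ≤ k-1`, intersect exactly at the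
origin of `ℂ^{3k-1}`. -/
theorem iInter_xSet_eq_singleton_origin
    (k : ℕ) (hk : 1 < k) (α β : ℝ) (hα : 0 < α) (hαβ : α < β) (hβ : β < 1) :
    (⋂ σ : {s : ℕ // 1 ≤ s ∧ s ≤ k-1},
      (xSet k hk α σ σ.2.1 σ.2.2 ∩ xSet k hk β σ σ.2.1 σ.2.2)) =
    {(0 : EuclideanSpace ℂ (Fin (3*k-1)))} := by
  refine Set.Subset.antisymm (fun Z hZ => ?_) ?_
  · have hσ : ∀ σ (h1 : 1 ≤ σ) (h2 : σ ≤ k-1), _ := fun σ h1 h2 =>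
      coords_of_mem_xSet_inter hα hαβ hβ (Set.mem_iInter.mp hZ ⟨σ, h1, h2⟩)
    obtain ⟨hz, hw₁, hw₂, hζ₁, hζk⟩ := hσ 1 le_rfl (by omega)
    replace hw₁ : Z ⟨1, by omega⟩ = 0 := self_eq_neg.mp (eq_neg_of_add_eq_zero_left hw₁)
    replace hw₂ : Z ⟨2, by omega⟩ = 0 := self_eq_neg.mp (eq_neg_of_add_eq_zero_left hw₂)
    have h2k : 2*k-2+1 = 2*k-1 := by omega
    simp only [h2k] at hζ₁
    replace hζ₁ : Z ⟨2*k-1, by omega⟩ = 0 := self_eq_neg.mp (eq_neg_of_add_eq_zero_left hζ₁)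
    refine Set.mem_singleton_iff.mpr (PiLp.ext fun ⟨i, hi⟩ => ?_)
    change Z ⟨i, hi⟩ = 0
    obtain rfl | hi0 := Nat.eq_zero_or_pos i
    · exact hz
    by_cases hiw : i ≤ 2*k-2
    · obtain ⟨σ, rfl | rfl⟩ : ∃ σ, i = 2*σ ∨ i = 2*σ-1 := ⟨(i+1)/2, by omega⟩
      · have := (hσ σ (by omega) (by omega)).2.2.1
        rwa [hw₂, zero_add] at this
      · have := (hσ σ (by omega) (by omega)).2.1
        rwa [hw₁, zero_add] at this
    · obtain ⟨σ, rfl⟩ : ∃ σ, i = 2*k-2+σ := ⟨i-(2*k-2), by omega⟩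
      by_cases hσk : σ ≤ k-1
      · have := (hσ σ (by omega) hσk).2.2.2.1
        rwa [hζ₁, zero_add] at this
      · obtain rfl : σ = k := by omega
        have h3k : 2*σ-2+σ = 3*σ-2 := by omega
        simpa only [h3k] using hζk
  · rintro _ rfl
    exact Set.mem_iInter.mpr fun σ => ⟨zero_mem_xSet .., zero_mem_xSet ..⟩
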